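/- arXiv:1611.06750 — 2 statements merged into one kernel-verified Lean document; each statement's English description precedes it below -/
import Mathlib

section
/- Let Ω ⊂ ℝ² be a bounded connected open set and let (K_ε)_{ε>0} be compact connected subsets of Ω concentrating to a point x₀ ∈ Ω, with diameters δ_ε = diam K_ε → 0. Then Cap_Ω(K_ε) = 2π/|log δ_ε| + O(1/log²δ_ε) as ε → 0⁺. -/
open MeasureTheory Metric Set Filter Asymptotics
open scoped Topology Real

noncomputable section

/-- Euclidean space `ℝⁿ`. -/
abbrev Euc (n : ℕ) := EuclideanSpace ℝ (Fin n)

/-- Model for membership in `H¹₀(Ω)`: smooth functions compactly supported in `Ω`. -/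
def IsTest {n : ℕ} (Ω : Set (Euc n)) (f : Euc n → ℝ) : Prop :=
  ContDiff ℝ (⊤ : ℕ∞) f ∧ tsupport f ⊆ Ω

/-- Dirichlet energy `∫_Ω |∇f|²`. -/
def energy {n : ℕ} (Ω : Set (Euc n)) (f : Euc n → ℝ) : ℝ :=
  ∫ x in Ω, ‖fderiv ℝ f x‖ ^ 2

/-- Condenser capacity `Cap_Ω(K)`: infimum of the Dirichlet energy over functions in
`H¹₀(Ω)` equal to `1` in a neighbourhood of `K`. -/
def cap {n : ℕ} (Ω K : Set (Euc n)) : ℝ :=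
  sInf { e : ℝ | ∃ f : Euc n → ℝ, IsTest Ω f ∧
    (∃ U, IsOpen U ∧ K ⊆ U ∧ EqOn f 1 U) ∧ e = energy Ω f }

/-- `u`-capacity `Cap_Ω(K, u)`: infimum of the Dirichlet energy over functions in
`H¹₀(Ω)` with `f - u ∈ H¹₀(Ω \ K)` (modelled as `f = u` in a neighbourhood of `K`). -/
def capU {n : ℕ} (Ω K : Set (Euc n)) (u : Euc n → ℝ) : ℝ :=
  sInf { e : ℝ | ∃ f : Euc n → ℝ, IsTest Ω f ∧
    (∃ U, IsOpen U ∧ K ⊆ U ∧ EqOn f u U) ∧ e = energy Ω f }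

/-- A family `(K_ε)` of compact sets concentrates to `K₀` if every open set containing
`K₀` contains `K_ε` for all sufficiently small `ε > 0`. -/
def Concentrates {n : ℕ} (K : ℝ → Set (Euc n)) (K₀ : Set (Euc n)) : Prop :=
  ∀ U : Set (Euc n), IsOpen U → K₀ ⊆ U → ∀ᶠ ε in 𝓝[>] (0:ℝ), K ε ⊆ U

/-- Rayleigh quotient of `f` on `Ω`. -/
def rayleigh {n : ℕ} (Ω : Set (Euc n)) (f : Euc n → ℝ) : ℝ :=
  energy Ω f / ∫ x in Ω, (f x) ^ 2

/-- `N`-th Dirichlet eigenvalue of `-Δ` on `Ω` via the Courant–Fischer min-max principle. -/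
def dirichletEig {n : ℕ} (Ω : Set (Euc n)) (N : ℕ) : ℝ :=
  sInf { t : ℝ | ∃ W : Submodule ℝ (Euc n → ℝ), Module.finrank ℝ W = N ∧
    (∀ f ∈ W, IsTest Ω f) ∧ ∀ f ∈ W, f ≠ 0 → rayleigh Ω f ≤ t }

/-- The Laplacian as a sum of second partial derivatives. -/
def lap {n : ℕ} (u : Euc n → ℝ) (x : Euc n) : ℝ :=
  ∑ i : Fin n, fderiv ℝ (fun y => fderiv ℝ u y (EuclideanSpace.single i 1)) x
    (EuclideanSpace.single i 1)

/-- `u` is a Dirichlet eigenfunction on `Ω` with eigenvalue `lam`. -/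
def IsEigenfun {n : ℕ} (Ω : Set (Euc n)) (lam : ℝ) (u : Euc n → ℝ) : Prop :=
  IsTest Ω u ∧ u ≠ 0 ∧ ∀ x ∈ Ω, - lap u x = lam * u x

lemma polar_lower (F P T : ℝ → ℝ → ℝ) (hP : Continuous (Function.uncurry P))
    (hT : Continuous (Function.uncurry T))
    (hFr : ∀ r θ, HasDerivAt (fun r => F r θ) (P r θ) r)
    (hFt : ∀ r θ, HasDerivAt (fun θ => F r θ) (r * T r θ) θ)
    (α R : ℝ) (hα : 0 < α) (hR : 2 * α ≤ R) (hF0 : ∀ θ, F R θ = 0)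
    (hF1 : ∀ r ∈ Icc α (2 * α), ∃ θ ∈ Icc (-π) π, F r θ = 1) :
    1 / (Real.log (R / α) / (2 * π) + 2 * π / Real.log 2) ≤
      ∫ r in α..R, ∫ θ in (-π)..π, r * ((P r θ) ^ 2 + (T r θ) ^ 2) := by
  have hpi := Real.pi_pos
  have hlog2 : 0 < Real.log 2 := Real.log_pos (by norm_num)
  have hR0 : 0 < R := by linarith
  have hL : 0 < Real.log (R / α) := Real.log_pos (by rw [lt_div_iff₀ hα]; linarith)
  have hpp : -π ≤ π := by linarith
  have hαR : α ≤ R := by linarith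
  have hα2 : α ≤ 2 * α := by linarith
  have cP : ∀ θ, Continuous (fun r => P r θ) := fun θ => by
    have : Continuous (fun r : ℝ => (r, θ)) := by fun_prop
    exact hP.comp this
  have cT : ∀ r, Continuous (fun θ => T r θ) := fun r => by
    have : Continuous (fun θ : ℝ => (r, θ)) := by fun_prop
    exact hT.comp this
  have cP' : ∀ r, Continuous (fun θ => P r θ) := fun r => by
    have : Continuous (fun θ : ℝ => (r, θ)) := by fun_prop
    exact hP.comp this
  -- basic integrals
  set IP : ℝ → ℝ := fun r => ∫ θ in (-π)..π, |P r θ| with hIP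
  set IT : ℝ → ℝ := fun r => ∫ θ in (-π)..π, |T r θ| with hIT
  have cIP : Continuous IP :=
    intervalIntegral.continuous_parametric_intervalIntegral_of_continuous' (f := fun r θ => |P r θ|)
      (by exact hP.abs) _ _
  have cIT : Continuous IT :=
    intervalIntegral.continuous_parametric_intervalIntegral_of_continuous' (f := fun r θ => |T r θ|)
      (by exact hT.abs) _ _
  have cH : Continuous (fun θ => ∫ t in α..R, |P t θ|) :=
    intervalIntegral.continuous_parametric_intervalIntegral_of_continuous' (f := fun θ r => |P r θ|)
      (by exact (hP.comp continuous_swap).abs) _ _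
  set B : ℝ := ∫ r in α..R, IP r with hB
  have hswap : ∫ θ in (-π)..π, (∫ t in α..R, |P t θ|) = B := by
    rw [hB, hIP]
    rw [MeasureTheory.intervalIntegral_intervalIntegral_swap]
    have : Continuous (Function.uncurry fun (θ r : ℝ) => |P r θ|) :=
      (hP.comp continuous_swap).abs
    have hc := this.continuousOn.integrableOn_compact (μ := volume)
      (isCompact_uIcc.prod isCompact_uIcc : IsCompact (uIcc (-π) π ×ˢ uIcc α R))
    exact hc.mono_set (Set.prod_mono uIoc_subset_uIcc uIoc_subset_uIcc)
  -- key pointwise inequality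
  have key : ∀ r ∈ Icc α (2 * α), 2 * π ≤ 2 * π * (r * IT r) + B := by
    intro r hr
    obtain ⟨θ₀, hθ₀, h1⟩ := hF1 r hr
    have hrpos : 0 < r := by linarith [hr.1]
    have hpt : ∀ θ ∈ Icc (-π) π, 1 ≤ r * IT r + ∫ t in α..R, |P t θ| := by
      intro θ hθ
      have e1 : F r θ₀ - F r θ = ∫ s in θ..θ₀, r * T r s := by
        rw [intervalIntegral.integral_eq_sub_of_hasDerivAt (fun x _ => hFt r x)]
        exact (continuous_const.mul (cT r)).intervalIntegrable _ _
      have e2 : F R θ - F r θ = ∫ t in r..R, P t θ := by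
        rw [intervalIntegral.integral_eq_sub_of_hasDerivAt (fun x _ => hFr x θ)]
        exact (cP θ).intervalIntegrable _ _
      have b1 : F r θ₀ - F r θ ≤ r * IT r := by
        rw [e1, intervalIntegral.integral_const_mul]
        apply mul_le_mul_of_nonneg_left _ hrpos.le
        refine (le_abs_self _).trans ?_
        refine (intervalIntegral.norm_integral_le_abs_integral_norm (f := fun s => T r s)).trans ?_
        rw [hIT]
        have := intervalIntegral.abs_integral_mono_interval (f := fun θ => |T r θ|) (μ := volume) (a := θ) (b := θ₀) (c := -π) (d := π) ?_ ?_ ?_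
        · rw [abs_of_nonneg (a := ∫ x in (-π)..π, _)] at this
          · exact this
          · exact intervalIntegral.integral_nonneg hpp (fun _ _ => abs_nonneg _)
        · apply uIoc_subset_uIoc_of_uIcc_subset_uIcc
          rw [uIcc_of_le hpp]
          exact uIcc_subset_Icc hθ hθ₀
        · exact Eventually.of_forall (fun _ => abs_nonneg _)
        · exact (cT r).abs.intervalIntegrable _ _
      have b2 : -(F R θ - F r θ) ≤ ∫ t in α..R, |P t θ| := by
        rw [e2]
        have hrR : r ≤ R := by linarith [hr.2]
        refine (neg_le_abs _).trans ?_
        refine (intervalIntegral.abs_integral_le_integral_abs hrR).trans ?_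
        exact intervalIntegral.integral_mono_interval hr.1 hrR le_rfl
          (Eventually.of_forall (fun _ => abs_nonneg _)) ((cP θ).abs.intervalIntegrable _ _)
      rw [hF0] at b2
      linarith
    have := intervalIntegral.integral_mono_on (μ := volume) hpp (f := fun _ => (1:ℝ))
      (g := fun θ => r * IT r + ∫ t in α..R, |P t θ|)
      (continuous_const.intervalIntegrable _ _)
      ((continuous_const.add cH).intervalIntegrable _ _) hpt
    rw [intervalIntegral.integral_add (continuous_const.intervalIntegrable _ _)
      (cH.intervalIntegrable _ _), hswap] at this
    simp at this
    linarith
  have cinv : ∀ b, α ≤ b → ContinuousOn (fun r : ℝ => r⁻¹) (uIcc α b) := by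
    intro b hb
    rw [uIcc_of_le hb]
    exact continuousOn_inv₀.mono (fun x hx => by
      have : 0 < x := lt_of_lt_of_le hα hx.1
      exact this.ne')
  have iinv : ∀ b, α ≤ b → ∫ r in α..b, r⁻¹ = Real.log (b / α) := fun b hb =>
    integral_inv_of_pos hα (by linarith)
  set S : ℝ := ∫ r in α..(2 * α), IT r with hS
  have h2 : Real.log (2 * α / α) = Real.log 2 := by
    congr 1; field_simp
  have keyint : (2 * π - B) * Real.log 2 ≤ 2 * π * S := by
    have := intervalIntegral.integral_mono_on (μ := volume) hα2 (f := fun r => (2 * π - B) * r⁻¹)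
      (g := fun r => 2 * π * IT r)
      ((continuousOn_const.mul (cinv _ hα2)).intervalIntegrable)
      ((continuous_const.mul cIT).intervalIntegrable _ _) (fun r hr => by
        have h := key r hr
        have hrpos : 0 < r := by linarith [hr.1]
        rw [← div_eq_mul_inv, div_le_iff₀ hrpos]
        linarith)
    rw [intervalIntegral.integral_const_mul, intervalIntegral.integral_const_mul, iinv _ hα2, h2]
      at this
    exact this
  -- lower bounds for the energies
  set EP : ℝ → ℝ := fun r => ∫ θ in (-π)..π, (P r θ) ^ 2 with hEP
  set ET : ℝ → ℝ := fun r => ∫ θ in (-π)..π, (T r θ) ^ 2 with hET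
  have cEP : Continuous EP :=
    intervalIntegral.continuous_parametric_intervalIntegral_of_continuous' (f := fun r θ => P r θ ^ 2)
      (by exact hP.pow 2) _ _
  have cET : Continuous ET :=
    intervalIntegral.continuous_parametric_intervalIntegral_of_continuous' (f := fun r θ => T r θ ^ 2)
      (by exact hT.pow 2) _ _
  have split : ∫ r in α..R, ∫ θ in (-π)..π, r * ((P r θ) ^ 2 + (T r θ) ^ 2)
      = (∫ r in α..R, r * EP r) + ∫ r in α..R, r * ET r := by
    have j1 : Continuous (fun r => r * EP r) := continuous_id.mul cEP
    have j2 : Continuous (fun r => r * ET r) := continuous_id.mul cET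
    rw [← intervalIntegral.integral_add (j1.intervalIntegrable _ _)
      (j2.intervalIntegrable _ _)]
    congr 1
    funext r
    have j3 : Continuous (fun θ => P r θ ^ 2) := (cP' r).pow 2
    have j4 : Continuous (fun θ => T r θ ^ 2) := (cT r).pow 2
    rw [intervalIntegral.integral_const_mul, intervalIntegral.integral_add
      (j3.intervalIntegrable _ _) (j4.intervalIntegrable _ _)]
    ring
  have onedim : ∀ (u : ℝ → ℝ) (_ : Continuous u) (c r : ℝ), 0 < r →
      2 * c * (∫ θ in (-π)..π, |u θ|) - c ^ 2 * (2 * π) * r⁻¹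
        ≤ r * ∫ θ in (-π)..π, u θ ^ 2 := by
    intro u hu c r hr
    have := intervalIntegral.integral_mono_on (μ := volume) hpp
      (f := fun θ => 2 * c * |u θ| - c ^ 2 * r⁻¹)
      (g := fun θ => r * u θ ^ 2)
      (((continuous_const.mul hu.abs).sub continuous_const).intervalIntegrable _ _)
      ((continuous_const.mul (hu.pow 2)).intervalIntegrable _ _) (fun θ _ => by
        have h : r * u θ ^ 2 - (2 * c * |u θ| - c ^ 2 * r⁻¹) = r * (|u θ| - c * r⁻¹) ^ 2 := by
          rw [← sq_abs (u θ)]; field_simp; ring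
        have : 0 ≤ r * (|u θ| - c * r⁻¹) ^ 2 := by positivity
        linarith)
    have j5 : Continuous (fun θ => 2 * c * |u θ|) := continuous_const.mul hu.abs
    rw [intervalIntegral.integral_sub (j5.intervalIntegrable _ _)
      (continuous_const.intervalIntegrable _ _), intervalIntegral.integral_const_mul,
      intervalIntegral.integral_const_mul, intervalIntegral.integral_const_mul] at this
    simp only [intervalIntegral.integral_const, smul_eq_mul] at this
    linarith
  have twodim : ∀ (u : ℝ → ℝ → ℝ) (b : ℝ), α ≤ b → (∀ r, Continuous (u r)) →
      Continuous (fun r => ∫ θ in (-π)..π, |u r θ|) →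
      Continuous (fun r => ∫ θ in (-π)..π, u r θ ^ 2) → ∀ c : ℝ,
      2 * c * (∫ r in α..b, ∫ θ in (-π)..π, |u r θ|) - c ^ 2 * (2 * π) * Real.log (b / α)
        ≤ ∫ r in α..b, r * ∫ θ in (-π)..π, u r θ ^ 2 := by
    intro u b hb hu h1 h2 c
    have i1 : IntervalIntegrable (fun r : ℝ => c ^ 2 * (2 * π) * r⁻¹) volume α b :=
      (continuousOn_const.mul (cinv _ hb)).intervalIntegrable
    have i2 : IntervalIntegrable (fun r : ℝ => 2 * c * (∫ θ in (-π)..π, |u r θ|)) volume α b :=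
      (continuous_const.mul h1).intervalIntegrable _ _
    have := intervalIntegral.integral_mono_on (μ := volume) hb
      (f := fun r => 2 * c * (∫ θ in (-π)..π, |u r θ|) - c ^ 2 * (2 * π) * r⁻¹)
      (g := fun r => r * ∫ θ in (-π)..π, u r θ ^ 2)
      (i2.sub i1) ((continuous_id.mul h2).intervalIntegrable _ _)
      (fun r hr => onedim (u r) (hu r) c r (by linarith [hr.1]))
    rw [intervalIntegral.integral_sub i2 i1, intervalIntegral.integral_const_mul,
      intervalIntegral.integral_const_mul, iinv _ hb] at this
    exact this
  have hmono : ∫ r in α..(2 * α), r * ET r ≤ ∫ r in α..R, r * ET r := by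
    apply intervalIntegral.integral_mono_interval le_rfl hα2 hR _
      ((continuous_id.mul cET).intervalIntegrable _ _)
    filter_upwards [ae_restrict_mem measurableSet_Ioc] with r hr
    exact mul_nonneg (hα.le.trans hr.1.le) (intervalIntegral.integral_nonneg hpp (fun _ _ => sq_nonneg _))
  rw [split]
  set Q := Real.log (R / α) / (2 * π) + 2 * π / Real.log 2 with hQ
  have hQ0 : 0 < Q := by positivity
  have p1 := twodim P R hαR cP' cIP cEP (1 / (2 * π * Q))
  have p2 := twodim T (2 * α) hα2 cT cIT cET (1 / (Q * Real.log 2))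
  rw [h2] at p2
  have p3 : 1 / Q ≤ (2 * (1 / (2 * π * Q)) * B
      - (1 / (2 * π * Q)) ^ 2 * (2 * π) * Real.log (R / α)) +
      (2 * (1 / (Q * Real.log 2)) * S - (1 / (Q * Real.log 2)) ^ 2 * (2 * π) * Real.log 2) := by
    have hS' : (2 * π - B) * Real.log 2 / (2 * π) ≤ S := by
      rw [div_le_iff₀ (by positivity)]; linarith
    have : 2 * (1 / (Q * Real.log 2)) * ((2 * π - B) * Real.log 2 / (2 * π))
      ≤ 2 * (1 / (Q * Real.log 2)) * S := by gcongr
    have e1 : 2 * (1 / (Q * Real.log 2)) * ((2 * π - B) * Real.log 2 / (2 * π))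
      = 2 / Q - 2 * (1 / (2 * π * Q)) * B := by field_simp
    have e2 : (1 / (2 * π * Q)) ^ 2 * (2 * π) * Real.log (R / α) +
      (1 / (Q * Real.log 2)) ^ 2 * (2 * π) * Real.log 2 = Q / Q ^ 2 := by
      nth_rewrite 3 [hQ]; field_simp
    have e3 : Q / Q ^ 2 = 1 / Q := by field_simp
    have e4 : 2 / Q = 1 / Q + 1 / Q := by ring
    linarith
  linarith

lemma clm_sq (A : ℂ →L[ℝ] ℝ) (w : ℂ) (hw : ‖w‖ = 1) :
    (A w) ^ 2 + (A (w * Complex.I)) ^ 2 ≤ ‖A‖ ^ 2 := by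
  set a := A w
  set b := A (w * Complex.I)
  have h1 : A ((a : ℝ) • w + (b : ℝ) • (w * Complex.I)) = a ^ 2 + b ^ 2 := by
    rw [map_add, map_smul, map_smul]; simp only [smul_eq_mul]; ring
  have h2 : ‖(a : ℝ) • w + (b : ℝ) • (w * Complex.I)‖ ^ 2 = a ^ 2 + b ^ 2 := by
    have : (a : ℝ) • w + (b : ℝ) • (w * Complex.I) = w * (a + b * Complex.I) := by
      simp only [Complex.real_smul]; ring
    rw [this, norm_mul, hw, one_mul, ← Complex.normSq_eq_norm_sq, Complex.normSq_add_mul_I]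
  have h3 := (le_abs_self _).trans (A.le_opNorm ((a : ℝ) • w + (b : ℝ) • (w * Complex.I)))
  rw [h1] at h3
  set N := ‖(a : ℝ) • w + (b : ℝ) • (w * Complex.I)‖
  have hN : 0 ≤ N := norm_nonneg _
  rw [← h2] at h3 ⊢
  rcases hN.eq_or_lt with h | h
  · rw [← h]; simp
  · have : N ≤ ‖A‖ := by
      rw [pow_two] at h3
      exact le_of_mul_le_mul_right h3 h
    gcongr

lemma complex_lower (g : ℂ → ℝ) (hg : ContDiff ℝ (⊤ : ℕ∞) g)
    (α R : ℝ) (hα : 0 < α) (hR : 2 * α ≤ R) (hg0 : ∀ z, R ≤ ‖z‖ → g z = 0)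
    (hg1 : ∀ r ∈ Icc α (2 * α), ∃ z, ‖z‖ = r ∧ g z = 1) :
    1 / (Real.log (R / α) / (2 * π) + 2 * π / Real.log 2) ≤ ∫ z, ‖fderiv ℝ g z‖ ^ 2 := by
  have hpi := Real.pi_pos
  have hpp : -π ≤ π := by linarith
  have hαR : α ≤ R := by linarith
  have hcs : HasCompactSupport g := by
    apply HasCompactSupport.intro (isCompact_closedBall (0:ℂ) R)
    intro z hz
    simp at hz
    exact hg0 z hz.le
  have hDc : Continuous (fderiv ℝ g) := hg.continuous_fderiv (by simp)
  have hint : Integrable (fun z => ‖fderiv ℝ g z‖ ^ 2) := by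
    apply Continuous.integrable_of_hasCompactSupport (by fun_prop)
    have := (hcs.fderiv (𝕜 := ℝ)).norm
    rw [hasCompactSupport_iff_eventuallyEq] at this ⊢
    filter_upwards [this] with z hz
    simp at hz
    simp [hz]
  let c : ℝ → ℝ → ℂ := fun r θ => r * (Real.cos θ + Real.sin θ * Complex.I)
  let w : ℝ → ℂ := fun θ => (Real.cos θ + Real.sin θ * Complex.I)
  have hw : ∀ θ, ‖w θ‖ = 1 := fun θ => by
    simp only [w]; push_cast; exact Complex.norm_cos_add_sin_mul_I θ
  have hcc : Continuous (fun p : ℝ × ℝ => c p.1 p.2) := by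
    simp only [c]; fun_prop
  have hwc : Continuous w := by simp only [w]; fun_prop
  have hdiff : Differentiable ℝ g := hg.differentiable (by simp)
  let P : ℝ → ℝ → ℝ := fun r θ => fderiv ℝ g (c r θ) (w θ)
  let T : ℝ → ℝ → ℝ := fun r θ => fderiv ℝ g (c r θ) (w θ * Complex.I)
  have hP : Continuous (Function.uncurry P) :=
    (hDc.comp hcc).clm_apply (hwc.comp continuous_snd)
  have hT : Continuous (Function.uncurry T) :=
    (hDc.comp hcc).clm_apply ((hwc.comp continuous_snd).mul continuous_const)
  have main := polar_lower (fun r θ => g (c r θ)) P T hP hT ?_ ?_ α R hα hR ?_ ?_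
  · refine main.trans ?_
    -- compare with integral over annulus
    let A : Set ℂ := {z | ‖z‖ ∈ Ioc α R}
    have hA : MeasurableSet A := measurable_norm measurableSet_Ioc
    have s1 : ∫ z in A, ‖fderiv ℝ g z‖ ^ 2 ≤ ∫ z, ‖fderiv ℝ g z‖ ^ 2 :=
      setIntegral_le_integral hint (Eventually.of_forall fun _ => sq_nonneg _)
    refine le_trans ?_ s1
    rw [← integral_indicator hA, ← Complex.integral_comp_polarCoord_symm]
    have s2 : ∫ p in polarCoord.target, p.1 • (A.indicator (fun z => ‖fderiv ℝ g z‖ ^ 2))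
        (Complex.polarCoord.symm p) = ∫ p in Ioc α R ×ˢ Ioo (-π) π,
          p.1 * ‖fderiv ℝ g (c p.1 p.2)‖ ^ 2 := by
      have hB : MeasurableSet (Ioc α R ×ˢ Ioo (-π) π) := measurableSet_Ioc.prod measurableSet_Ioo
      rw [← integral_indicator polarCoord.open_target.measurableSet, ← integral_indicator hB]
      congr 1
      funext p
      by_cases hp : p ∈ Ioc α R ×ˢ Ioo (-π) π
      · have hp0 : 0 < p.1 := hα.trans hp.1.1
        have hpt : p ∈ polarCoord.target := ⟨hp0, hp.2⟩
        rw [indicator_of_mem hp, indicator_of_mem hpt, indicator_of_mem]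
        · rw [Complex.polarCoord_symm_apply, smul_eq_mul]
        · simp only [A, mem_ofPred_eq, Complex.norm_polarCoord_symm, abs_of_pos hp0]
          exact hp.1
      · rw [indicator_of_notMem hp]
        by_cases hpt : p ∈ polarCoord.target
        · rw [indicator_of_mem hpt, indicator_of_notMem, smul_zero]
          intro h
          have hp0 : 0 < p.1 := hpt.1
          simp only [A, mem_ofPred_eq, Complex.norm_polarCoord_symm, abs_of_pos hp0] at h
          exact hp ⟨h, hpt.2⟩
        · rw [indicator_of_notMem hpt]
    rw [s2]
    have cPT : Continuous (fun p : ℝ × ℝ => p.1 * ((P p.1 p.2) ^ 2 + (T p.1 p.2) ^ 2)) :=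
      continuous_fst.mul ((hP.pow 2).add (hT.pow 2))
    have cN : Continuous (fun p : ℝ × ℝ => p.1 * ‖fderiv ℝ g (c p.1 p.2)‖ ^ 2) :=
      continuous_fst.mul ((hDc.comp hcc).norm.pow 2)
    have hio : ∀ u : ℝ × ℝ → ℝ, Continuous u →
        IntegrableOn u (Ioc α R ×ˢ Ioo (-π) π) (volume.prod volume) := by
      intro u hu
      exact (hu.continuousOn.integrableOn_compact (isCompact_Icc.prod isCompact_Icc)).mono_set
        (Set.prod_mono Ioc_subset_Icc_self Ioo_subset_Icc_self)
    have s3 : ∫ r in α..R, ∫ θ in (-π)..π, r * ((P r θ) ^ 2 + (T r θ) ^ 2)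
        = ∫ p in Ioc α R ×ˢ Ioo (-π) π, p.1 * ((P p.1 p.2) ^ 2 + (T p.1 p.2) ^ 2) := by
      rw [Measure.volume_eq_prod, setIntegral_prod _ (hio _ cPT),
        intervalIntegral.integral_of_le hαR]
      congr 1
      funext r
      rw [intervalIntegral.integral_of_le hpp, integral_Ioc_eq_integral_Ioo]
    rw [s3]
    apply setIntegral_mono_on (hio _ cPT) (hio _ cN) (measurableSet_Ioc.prod measurableSet_Ioo)
    intro p hp
    exact mul_le_mul_of_nonneg_left (clm_sq _ _ (hw _)) (hα.trans hp.1.1).le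
  · intro r θ
    have h1 : HasDerivAt (fun r : ℝ => c r θ) (w θ) r := by
      have := (Complex.ofRealCLM.hasDerivAt (x := r)).mul_const (w θ)
      simpa [c, w] using this
    exact (hdiff (c r θ)).hasFDerivAt.comp_hasDerivAt r h1
  · intro r θ
    have h1 : HasDerivAt (fun θ : ℝ => c r θ) (r • (w θ * Complex.I)) θ := by
      have a1 := (Real.hasDerivAt_cos θ).ofReal_comp
      have a2 := ((Real.hasDerivAt_sin θ).ofReal_comp).mul_const Complex.I
      have := (a1.add a2).const_mul (r : ℂ)
      refine this.congr_deriv ?_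
      simp only [w, Complex.real_smul]
      push_cast
      ring_nf
      rw [Complex.I_sq]; ring
    have := (hdiff (c r θ)).hasFDerivAt.comp_hasDerivAt θ h1
    rw [map_smul] at this
    exact this
  · intro θ
    apply hg0
    have : c R θ = R * w θ := rfl
    rw [this, norm_mul, hw, Complex.norm_real, mul_one]
    exact le_abs_self _
  · intro r hr
    obtain ⟨z, hz, hz1⟩ := hg1 r hr
    refine ⟨Complex.arg z, ⟨(Complex.neg_pi_lt_arg z).le, Complex.arg_le_pi z⟩, ?_⟩
    rw [← hz1]
    congr 1
    simp only [c]
    rw [← hz]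
    push_cast
    exact Complex.norm_mul_cos_add_sin_mul_I z

lemma energy_lower (Ω K : Set (Euc 2)) (R : ℝ) (x₁ : Euc 2) (hx₁ : x₁ ∈ K)
    (hKc : IsConnected K) (hKb : Bornology.IsBounded K) (hK0 : 0 < Metric.diam K)
    (hKR : Metric.diam K ≤ R) (hΩ : Ω ⊆ Metric.ball x₁ R)
    (f : Euc 2 → ℝ) (hf : IsTest Ω f) (hfK : ∀ x ∈ K, f x = 1) :
    1 / (Real.log (R / (Metric.diam K / 8)) / (2 * π) + 2 * π / Real.log 2) ≤ energy Ω f := by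
  set δ := Metric.diam K with hδ
  have hE : energy Ω f = ∫ x, ‖fderiv ℝ f x‖ ^ 2 := by
    unfold energy
    apply setIntegral_eq_integral_of_forall_compl_eq_zero
    intro x hx
    have : x ∉ tsupport f := fun h => hx (hf.2 h)
    rw [fderiv_of_notMem_tsupport ℝ this]
    simp
  let ι : ℂ ≃ₗᵢ[ℝ] EuclideanSpace ℝ (Fin 2) := Complex.orthonormalBasisOneI.repr
  have hgd : ∀ z, ‖fderiv ℝ (fun z => f (x₁ + ι z)) z‖ = ‖fderiv ℝ f (x₁ + ι z)‖ := by
    intro z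
    have h1 : HasFDerivAt (fun z => x₁ + ι z) (ι.toContinuousLinearEquiv : ℂ →L[ℝ] Euc 2) z :=
      (ι.toContinuousLinearEquiv.hasFDerivAt (x := z)).const_add x₁
    have h2 := ((hf.1.differentiable (by simp)) (x₁ + ι z)).hasFDerivAt.comp z h1
    have h3 := h2.fderiv
    simp only [Function.comp_def] at h3
    rw [h3]
    exact ContinuousLinearMap.opNorm_comp_linearIsometryEquiv _ ι
  have hE2 : ∫ x, ‖fderiv ℝ f x‖ ^ 2 = ∫ z, ‖fderiv ℝ (fun z => f (x₁ + ι z)) z‖ ^ 2 := by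
    simp_rw [hgd]
    rw [ι.measurePreserving.integral_comp ι.toHomeomorph.measurableEmbedding
      (fun y => ‖fderiv ℝ f (x₁ + y)‖ ^ 2)]
    rw [integral_add_left_eq_self (fun y => ‖fderiv ℝ f y‖ ^ 2) x₁]
  rw [hE, hE2]
  apply complex_lower
  · exact hf.1.comp (contDiff_const.add ι.contDiff)
  · positivity
  · linarith
  · intro z hz
    have : x₁ + ι z ∉ tsupport f := fun h => by
      have := hΩ (hf.2 h)
      rw [mem_ball, dist_eq_norm, add_sub_cancel_left, ι.norm_map] at this
      linarith
    exact image_eq_zero_of_notMem_tsupport this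
  · intro r hr
    have hy : ∃ y ∈ K, δ / 4 < dist y x₁ := by
      by_contra! hcon
      have : Metric.diam K ≤ 2 * (δ / 4) :=
        Metric.diam_le_of_subset_closedBall (by positivity) (x := x₁) (fun y hy => hcon y hy)
      linarith
    obtain ⟨y, hyK, hy⟩ := hy
    have hp := hKc.isPreconnected.intermediate_value hx₁ hyK (f := fun y => dist y x₁)
      (by fun_prop)
    have hr' : r ∈ Icc (dist x₁ x₁) (dist y x₁) := by
      rw [dist_self]
      exact ⟨by linarith [hr.1], by linarith [hr.2]⟩
    obtain ⟨w, hwK, hw⟩ := hp hr'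
    refine ⟨ι.symm (w - x₁), ?_, ?_⟩
    · rw [ι.symm.norm_map, ← dist_eq_norm]; exact hw
    · simp [hfK w hwK]

lemma exists_profile (a b : ℝ) (hab : 2 < b - a) : ∃ φ : ℝ → ℝ, ContDiff ℝ (⊤ : ℕ∞) φ ∧
    (∀ s ≤ a, φ s = 1) ∧ (∀ s, b ≤ s → φ s = 0) ∧ ∀ s, |deriv φ s| ≤ 1 / (b - a - 2) := by
  let ψ : ContDiffBump ((a + b) / 2) :=
    ⟨(b - a - 2) / 2, (b - a) / 2, by linarith, by linarith⟩
  have hT : b - a - 2 ≤ ∫ x, ψ x := by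
    have := ψ.measure_closedBall_le_integral volume
    rw [Real.volume_real_closedBall (by simp only [ψ]; linarith)] at this
    simp only [ψ] at this ⊢
    linarith
  set T := ∫ x, ψ x with hTd
  have hT0 : 0 < T := by linarith
  have hsupp : Function.support ψ = Ioo a b := by
    rw [ψ.support_eq, Real.ball_eq_Ioo]
    simp only [ψ]
    congr 1 <;> ring
  have hψc : Continuous ψ := ψ.continuous
  have hd : ∀ s, HasDerivAt (fun s => 1 - (∫ t in a..s, ψ t) / T) (-(ψ s / T)) s := by
    intro s
    exact ((hψc.integral_hasStrictDerivAt a s).hasDerivAt.div_const T).const_sub 1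
  have hderiv : deriv (fun s => 1 - (∫ t in a..s, ψ t) / T) = fun s => -(ψ s / T) :=
    funext fun s => (hd s).deriv
  refine ⟨fun s => 1 - (∫ t in a..s, ψ t) / T, ?_, ?_, ?_, ?_⟩
  · rw [contDiff_infty_iff_deriv]
    refine ⟨fun s => (hd s).differentiableAt, ?_⟩
    rw [hderiv]
    exact (ψ.contDiff.div_const T).neg
  · intro s hs
    have : ∫ t in a..s, ψ t = 0 := by
      rw [intervalIntegral.integral_congr (g := fun _ => (0:ℝ))]
      · simp
      · intro t ht
        rw [uIcc_of_ge hs] at ht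
        by_contra h
        have : t ∈ Function.support ψ := h
        rw [hsupp] at this
        linarith [this.1, ht.2]
    simp [this]
  · intro s hs
    have : ∫ t in a..s, ψ t = T := by
      apply intervalIntegral.integral_eq_integral_of_support_subset
      rw [hsupp]
      exact fun t ht => ⟨ht.1, ht.2.le.trans hs⟩
    simp only [this]
    rw [div_self hT0.ne']; ring
  · intro s
    rw [hderiv]
    simp only
    rw [abs_neg, abs_of_nonneg (div_nonneg ψ.nonneg hT0.le)]
    have : 0 < b - a - 2 := by linarith
    exact div_le_div₀ zero_le_one ψ.le_one this hT

lemma upper_test (Ω K : Set (Euc 2)) (x₁ : Euc 2) (a b : ℝ) (hab : 2 < b - a)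
    (hK : K ⊆ ball x₁ (Real.exp a)) (hΩ : closedBall x₁ (Real.exp b) ⊆ Ω) :
    ∃ f : Euc 2 → ℝ, IsTest Ω f ∧ (∃ U, IsOpen U ∧ K ⊆ U ∧ EqOn f 1 U) ∧
      energy Ω f ≤ 2 * π * (b - a) / (b - a - 2) ^ 2 := by
  obtain ⟨φ, hφ, hφ1, hφ0, hφd⟩ := exists_profile a b hab
  let f : Euc 2 → ℝ := fun x => if dist x x₁ < Real.exp a then 1 else φ (Real.log ‖x - x₁‖)
  have hf1 : ∀ x ∈ ball x₁ (Real.exp a), f x = 1 := fun x hx => if_pos hx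
  have hf2 : ∀ x, x ≠ x₁ → f x = φ (Real.log ‖x - x₁‖) := by
    intro x hx
    by_cases h : dist x x₁ < Real.exp a
    · rw [hf1 x h, hφ1]
      rw [← dist_eq_norm]
      exact ((Real.log_lt_iff_lt_exp (dist_pos.2 hx)).2 h).le
    · exact if_neg h
  have hf3 : ∀ x, Real.exp b ≤ dist x x₁ → f x = 0 := by
    intro x hx
    have hpos : 0 < dist x x₁ := (Real.exp_pos b).trans_le hx
    rw [hf2 x (dist_pos.1 hpos), hφ0]
    rw [← dist_eq_norm]
    exact (Real.le_log_iff_exp_le hpos).2 hx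
  have ev1 : ∀ x ∈ ball x₁ (Real.exp a), f =ᶠ[𝓝 x] fun _ => 1 := fun x hx => by
    filter_upwards [isOpen_ball.mem_nhds hx] with y hy using hf1 y hy
  have ev2 : ∀ x, x ≠ x₁ → f =ᶠ[𝓝 x] fun x => φ (Real.log ‖x - x₁‖) := fun x hx => by
    filter_upwards [isOpen_ne.mem_nhds hx] with y hy using hf2 y hy
  have ev3 : ∀ x, Real.exp b < dist x x₁ → f =ᶠ[𝓝 x] fun _ => 0 := fun x hx => by
    have : IsOpen {y | Real.exp b < dist y x₁} := isOpen_lt continuous_const (by fun_prop)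
    filter_upwards [this.mem_nhds hx] with y hy using hf3 y (le_of_lt hy)
  have hsub : ContDiff ℝ (⊤ : ℕ∞) (fun x : Euc 2 => x - x₁) := contDiff_id.sub contDiff_const
  have hsm : ContDiff ℝ (⊤ : ℕ∞) f := by
    rw [contDiff_iff_contDiffAt]
    intro x
    by_cases hx : x = x₁
    · have : x ∈ ball x₁ (Real.exp a) := by rw [hx]; exact mem_ball_self (Real.exp_pos a)
      exact contDiffAt_const.congr_of_eventuallyEq (ev1 x this)
    · refine ContDiffAt.congr_of_eventuallyEq ?_ (ev2 x hx)
      have hne : x - x₁ ≠ 0 := sub_ne_zero.2 hx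
      exact hφ.contDiffAt.comp x ((hsub.contDiffAt.norm ℝ hne).log (norm_ne_zero_iff.2 hne))
  have hts : tsupport f ⊆ Ω := by
    refine Subset.trans ?_ hΩ
    apply closure_minimal _ isClosed_closedBall
    intro x hx
    by_contra h
    rw [mem_closedBall, not_le] at h
    exact hx (hf3 x h.le)
  refine ⟨f, ⟨hsm, hts⟩, ⟨ball x₁ (Real.exp a), isOpen_ball, hK, fun x hx => hf1 x hx⟩, ?_⟩
  set M := 1 / (b - a - 2) with hM
  have hM0 : 0 ≤ M := by rw [hM]; apply one_div_nonneg.2; linarith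
  let v : ℝ → ℝ := (Icc (Real.exp a) (Real.exp b)).indicator (fun r => M ^ 2 / r ^ 2)
  have hv0 : ∀ r, 0 ≤ v r := fun r => indicator_nonneg (fun _ _ => by positivity) r
  have hle : ∀ x, ‖fderiv ℝ f x‖ ^ 2 ≤ v ‖x - x₁‖ := by
    intro x
    by_cases h1 : dist x x₁ < Real.exp a
    · rw [(ev1 x h1).fderiv_eq]; simpa using hv0 _
    by_cases h3 : Real.exp b < dist x x₁
    · rw [(ev3 x h3).fderiv_eq]; simpa using hv0 _
    push Not at h1 h3
    have hr : 0 < dist x x₁ := (Real.exp_pos a).trans_le h1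
    have hx : x ≠ x₁ := dist_pos.1 hr
    have hne : x - x₁ ≠ 0 := sub_ne_zero.2 hx
    rw [dist_eq_norm] at h1 h3 hr
    have hv : v ‖x - x₁‖ = M ^ 2 / ‖x - x₁‖ ^ 2 := indicator_of_mem (by exact ⟨h1, h3⟩) _
    rw [hv, (ev2 x hx).fderiv_eq]
    have d1 : HasFDerivAt (fun x : Euc 2 => ‖x - x₁‖) (fderiv ℝ (fun x : Euc 2 => ‖x - x₁‖) x) x :=
      (((hsub.contDiffAt (x := x)).norm ℝ hne).differentiableAt (by simp)).hasFDerivAt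
    have n1 : ‖fderiv ℝ (fun x : Euc 2 => ‖x - x₁‖) x‖ ≤ 1 := by
      have hl : LipschitzWith 1 (fun x : Euc 2 => ‖x - x₁‖) := by
        apply LipschitzWith.of_dist_le_mul
        intro y z
        simpa [dist_eq_norm] using abs_norm_sub_norm_le (y - x₁) (z - x₁)
      exact norm_fderiv_le_of_lipschitz ℝ hl
    have d2 : HasDerivAt (fun r => φ (Real.log r)) (deriv φ (Real.log ‖x - x₁‖) * ‖x - x₁‖⁻¹) ‖x - x₁‖ :=
      ((hφ.differentiable (by simp)) _).hasDerivAt.comp _ (Real.hasDerivAt_log hr.ne')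
    have d3 := (d2.comp_hasFDerivAt x d1).fderiv
    simp only [Function.comp_def] at d3
    rw [d3, norm_smul, ← div_pow]
    gcongr
    rw [norm_mul, norm_inv, norm_norm, Real.norm_eq_abs, div_eq_mul_inv]
    calc _ ≤ M * ‖x - x₁‖⁻¹ * 1 := by
            gcongr
            exact hφd _
      _ = _ := mul_one _
  have hvint0 : Integrable (fun x : Euc 2 => v ‖x‖) := by
    let A : Set (Euc 2) := {x | ‖x‖ ∈ Icc (Real.exp a) (Real.exp b)}
    have hAcl : IsClosed A := isClosed_Icc.preimage continuous_norm
    have hAc : IsCompact A := (isCompact_closedBall (0 : Euc 2) (Real.exp b)).of_isClosed_subset hAcl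
      (fun x hx => by simpa using hx.2)
    have hAi : IntegrableOn (fun x : Euc 2 => M ^ 2 / ‖x‖ ^ 2) A := by
      apply ContinuousOn.integrableOn_compact hAc
      apply ContinuousOn.div (by fun_prop) (by fun_prop)
      intro x hx
      have : 0 < ‖x‖ := (Real.exp_pos a).trans_le hx.1
      positivity
    exact (integrable_indicator_iff hAcl.measurableSet).2 hAi
  have hvint : Integrable (fun x : Euc 2 => v ‖x - x₁‖) := hvint0.comp_sub_right x₁
  have i1 : energy Ω f ≤ ∫ x, v ‖x - x₁‖ := by
    unfold energy
    refine le_trans (integral_mono_of_nonneg (Eventually.of_forall fun _ => sq_nonneg _)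
      hvint.integrableOn (Eventually.of_forall hle)) ?_
    exact setIntegral_le_integral hvint (Eventually.of_forall fun _ => hv0 _)
  refine i1.trans (le_of_eq ?_)
  rw [integral_sub_right_eq_self (fun x : Euc 2 => v ‖x‖) x₁, integral_fun_norm_addHaar]
  have hvol : volume.real (ball (0 : Euc 2) 1) = π := by
    rw [Measure.real, EuclideanSpace.volume_ball_fin_two]
    simp [Real.pi_nonneg]
  have hI : ∫ y in Ioi (0:ℝ), y ^ (Module.finrank ℝ (Euc 2) - 1) • v y = M ^ 2 * (b - a) := by
    have e1 : ∫ y in Ioi (0:ℝ), y ^ (Module.finrank ℝ (Euc 2) - 1) • v y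
        = ∫ y in Icc (Real.exp a) (Real.exp b), M ^ 2 * y⁻¹ := by
      rw [← integral_indicator measurableSet_Ioi, ← integral_indicator measurableSet_Icc]
      congr 1
      funext y
      by_cases hy : y ∈ Icc (Real.exp a) (Real.exp b)
      · have hy0 : 0 < y := (Real.exp_pos a).trans_le hy.1
        have hy0' : y ∈ Ioi (0:ℝ) := hy0
        simp only [indicator_of_mem hy, indicator_of_mem hy0', v, finrank_euclideanSpace_fin,
          smul_eq_mul]
        field_simp
        norm_num
        ring
      · rw [indicator_of_notMem hy]
        have : v y = 0 := indicator_of_notMem hy _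
        simp [indicator, this]
    rw [e1, integral_Icc_eq_integral_Ioc, ← intervalIntegral.integral_of_le
      (Real.exp_le_exp.2 (by linarith)), intervalIntegral.integral_const_mul,
      integral_inv_of_pos (Real.exp_pos _) (Real.exp_pos _), ← Real.exp_sub, Real.log_exp]
  rw [hI, hvol, finrank_euclideanSpace_fin, hM]
  simp only [nsmul_eq_mul, smul_eq_mul]
  push_cast
  field_simp

lemma recip_bound (c l : ℝ) (hl : 2 * |c| + 1 ≤ l) :
    |2 * π / (l + c) - 2 * π / l| ≤ 4 * π * |c| * (1 / l ^ 2) := by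
  have hpi := Real.pi_pos
  have hc0 := abs_nonneg c
  have hl0 : 0 < l := by linarith
  have hlc : l / 2 ≤ l + c := by linarith [neg_abs_le c]
  have hlc0 : 0 < l + c := by linarith
  have e : 2 * π / (l + c) - 2 * π / l = -(2 * π * c) / ((l + c) * l) := by
    field_simp; ring
  rw [e, abs_div, abs_neg, abs_mul, abs_of_pos (by positivity : 0 < 2 * π),
    abs_of_pos (by positivity : 0 < (l + c) * l)]
  have : 4 * π * |c| * (1 / l ^ 2) = 2 * π * |c| / (l / 2 * l) := by field_simp; ring
  rw [this]
  gcongr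

/-- for compact connected sets  concentrating to a point, with
diameters , one has . -/
theorem stmt_5 (Ω : Set (Euc 2)) (hΩb : Bornology.IsBounded Ω)
    (hΩc : IsConnected Ω) (hΩo : IsOpen Ω)
    (K : ℝ → Set (Euc 2))
    (hK : ∀ ε > (0:ℝ), IsCompact (K ε) ∧ IsConnected (K ε) ∧ K ε ⊆ Ω)
    (x₀ : Euc 2) (hx₀ : x₀ ∈ Ω) (hconc : Concentrates K {x₀})
    (hδpos : ∀ ε > (0:ℝ), 0 < Metric.diam (K ε))
    (hδ : Tendsto (fun ε => Metric.diam (K ε)) (𝓝[>] (0:ℝ)) (𝓝 0)) :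
    (fun ε => cap Ω (K ε) - 2 * Real.pi / |Real.log (Metric.diam (K ε))|)
      =O[𝓝[>] (0:ℝ)] (fun ε => 1 / (Real.log (Metric.diam (K ε))) ^ 2) := by
  have hpi := Real.pi_pos
  have hlog2 : 0 < Real.log 2 := Real.log_pos (by norm_num)
  obtain ⟨ρ, hρ, hρΩ⟩ := Metric.isOpen_iff.1 hΩo x₀ hx₀
  set R := Metric.diam Ω + 1 with hR
  have hR0 : 0 < R := by have := Metric.diam_nonneg (s := Ω); linarith
  set c1 := Real.log (8 * R) + 4 * π ^ 2 / Real.log 2 with hc1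
  set c2 := Real.log (ρ / 4) - 5 with hc2
  have hev : ∀ᶠ ε in 𝓝[>] (0:ℝ), 0 < ε := eventually_mem_nhdsWithin
  have hc := hconc (ball x₀ (ρ / 4)) isOpen_ball
    (singleton_subset_iff.2 (mem_ball_self (by positivity)))
  set m := Real.log 2 + 2 * |c1| + 2 * |c2| + 1 + |Real.log (ρ / 4)| + 5 with hm
  have hsmall : ∀ᶠ ε in 𝓝[>] (0:ℝ), Metric.diam (K ε) < Real.exp (-m) :=
    hδ.eventually (gt_mem_nhds (Real.exp_pos _))
  apply IsBigO.of_bound (4 * π * |c1| + 4 * π * |c2|)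
  filter_upwards [hev, hc, hsmall] with ε hε hcε hsε
  obtain ⟨hKc, hKconn, hKΩ⟩ := hK ε hε
  have hd0 := hδpos ε hε
  obtain ⟨x₁, hx₁⟩ := hKconn.nonempty
  set δ := Metric.diam (K ε) with hδd
  set l := -Real.log δ with hl
  have hlm : m < l := by
    have := (Real.log_lt_iff_lt_exp hd0).2 hsε
    linarith
  have a1 := abs_nonneg c1
  have a2 := abs_nonneg c2
  have a3 := abs_nonneg (Real.log (ρ / 4))
  have a4 := neg_abs_le (Real.log (ρ / 4))
  have hl0 : 0 < l := by linarith
  have habs : |Real.log δ| = l := by rw [hl, abs_of_neg]; linarith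
  have hsq : Real.log δ ^ 2 = l ^ 2 := by rw [hl]; ring
  -- test function
  have hx₁ball : dist x₁ x₀ < ρ / 4 := hcε hx₁
  obtain ⟨f, hft, hfU, hfE⟩ := upper_test Ω (K ε) x₁ (Real.log (2 * δ)) (Real.log (ρ / 2))
    (by
      rw [Real.log_mul two_ne_zero hd0.ne', show ρ / 2 = 2 * (ρ / 4) by ring,
        Real.log_mul two_ne_zero (by positivity)]
      linarith)
    (by
      rw [Real.exp_log (by positivity)]
      intro y hy
      have := Metric.dist_le_diam_of_mem hKc.isBounded hy hx₁
      rw [mem_ball]; linarith)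
    (by
      rw [Real.exp_log (by positivity)]
      intro y hy
      apply hρΩ
      rw [mem_closedBall] at hy
      rw [mem_ball]
      linarith [dist_triangle y x₁ x₀])
  have hL : Real.log (ρ / 2) - Real.log (2 * δ) = l + c2 + 5 := by
    rw [Real.log_mul two_ne_zero hd0.ne', show ρ / 2 = 2 * (ρ / 4) by ring,
        Real.log_mul two_ne_zero (by positivity)]
    rw [hc2, hl]; ring
  have hlc2 : 0 < l + c2 := by linarith [neg_abs_le c2]
  have hup : cap Ω (K ε) ≤ 2 * π / (l + c2) := by
    have h1 : cap Ω (K ε) ≤ energy Ω f := by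
      apply csInf_le
      · refine ⟨0, ?_⟩
        rintro e ⟨f, -, -, rfl⟩
        exact integral_nonneg (fun _ => sq_nonneg _)
      · exact ⟨f, hft, hfU, rfl⟩
    refine h1.trans (hfE.trans ?_)
    rw [hL, div_le_div_iff₀ (by nlinarith) hlc2, mul_assoc]
    rw [mul_assoc]
    nlinarith
  have hlow : 2 * π / (l + c1) ≤ cap Ω (K ε) := by
    refine le_csInf (s := { e : ℝ | ∃ f : Euc 2 → ℝ, IsTest Ω f ∧
      (∃ U, IsOpen U ∧ K ε ⊆ U ∧ EqOn f 1 U) ∧ e = energy Ω f }) ⟨_, f, hft, hfU, rfl⟩ ?_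
    rintro e ⟨g, hgt, ⟨U, -, hKU, hgU⟩, rfl⟩
    have hdR : δ ≤ Metric.diam Ω := Metric.diam_mono hKΩ hΩb
    have := energy_lower Ω (K ε) R x₁ hx₁ hKconn hKc.isBounded hd0 (by linarith)
      (fun y hy => by
        rw [mem_ball]
        linarith [Metric.dist_le_diam_of_mem hΩb hy (hKΩ hx₁)]) g hgt (fun x hx => hgU (hKU hx))
    refine le_trans (le_of_eq ?_) this
    have e1 : Real.log (R / (δ / 8)) = Real.log (8 * R) + l := by
      rw [show R / (δ / 8) = 8 * R / δ by field_simp, Real.log_div (by positivity) hd0.ne', hl]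
      ring
    rw [← hδd, e1, hc1]
    have : (Real.log (8 * R) + l) / (2 * π) + 2 * π / Real.log 2 =
      (l + (Real.log (8 * R) + 4 * π ^ 2 / Real.log 2)) / (2 * π) := by field_simp; ring
    rw [this, one_div_div]
  have r1 := recip_bound c1 l (by linarith)
  have r2 := recip_bound c2 l (by linarith)
  rw [habs, hsq, Real.norm_eq_abs, Real.norm_eq_abs,
    abs_of_nonneg (by positivity : 0 ≤ 1 / l ^ 2), add_mul]
  have q1 : 0 ≤ 4 * π * |c1| * (1 / l ^ 2) := by positivity
  have q2 : 0 ≤ 4 * π * |c2| * (1 / l ^ 2) := by positivity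
  rw [abs_le] at r1 r2 ⊢
  constructor <;> linarith [r1.1, r1.2, r2.1, r2.2]
end
end

section
/- Let E_ε(L) = {(x₁,x₂) ∈ ℝ² : x₁²/(L²+ε²) + x₂²/L² < 1} and s_ε = [−ε,ε] × {0}. Then the condenser capacity of s_ε in E_ε(L) satisfies Cap_{E_ε(L)}(s_ε) = (2π/|log ε|)(1 + O(1/|log ε|)) as ε → 0⁺. -/
open MeasureTheory Metric Set Filter Asymptotics
open scoped Topology Real

noncomputable section

/-- The interior of the ellipse with foci at distance ε and semi-axes √(L²+ε²), L. -/
def ellipse (eps L : ℝ) : Set (Euc 2) :=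
  {x : Euc 2 | (x 0) ^ 2 / (L ^ 2 + eps ^ 2) + (x 1) ^ 2 / L ^ 2 < 1}

/-- The segment [−ε,ε] × {0} in the plane. -/
def seg (eps : ℝ) : Set (Euc 2) :=
  {x : Euc 2 | x 0 ∈ Set.Icc (-eps) eps ∧ x 1 = 0}

lemma exists_profile_s8 (ε R : ℝ) (hε : 0 < ε) (hR : 3 * ε < R) :
    ∃ g : ℝ → ℝ, ContDiff ℝ (⊤ : ℕ∞) g ∧ (∀ s, 0 ≤ g s) ∧ (∀ s, s * g s ≤ 1) ∧
      (∀ s ∈ Icc (3 * ε) R, g s = s⁻¹) ∧ (∀ s, s ≤ 2 * ε → g s = 0) ∧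
      (∀ s, R + ε ≤ s → g s = 0) := by
  let ψ : ContDiffBump ((R + 3 * ε) / 2) :=
    ⟨(R - 3 * ε) / 2, (R - 3 * ε) / 2 + ε, by linarith, by linarith⟩
  have z1 : ∀ s, s ≤ 2 * ε → ψ s = 0 := by
    intro s hs
    apply ψ.zero_of_le_dist
    rw [Real.dist_eq, abs_sub_comm]
    refine le_trans ?_ (le_abs_self _)
    show (R - 3 * ε) / 2 + ε ≤ _
    linarith
  have z2 : ∀ s, R + ε ≤ s → ψ s = 0 := by
    intro s hs
    apply ψ.zero_of_le_dist
    rw [Real.dist_eq]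
    refine le_trans ?_ (le_abs_self _)
    show (R - 3 * ε) / 2 + ε ≤ _
    linarith
  refine ⟨fun s => ψ s * s⁻¹, ?_, ?_, ?_, ?_, ?_, ?_⟩
  · rw [contDiff_iff_contDiffAt]
    intro s
    rcases lt_or_ge s (2 * ε) with h | h
    · have : (fun s => ψ s * s⁻¹) =ᶠ[𝓝 s] fun _ => 0 := by
        filter_upwards [Iio_mem_nhds h] with t ht
        rw [z1 t (le_of_lt ht), zero_mul]
      exact contDiffAt_const.congr_of_eventuallyEq this
    · exact ψ.contDiffAt.mul (contDiffAt_inv ℝ (by linarith))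
  · intro s
    rcases lt_or_ge s (2 * ε) with h | h
    · simp [z1 s h.le]
    · exact mul_nonneg ψ.nonneg (inv_nonneg.2 (by linarith))
  · intro s
    rcases lt_or_ge s (2 * ε) with h | h
    · simp [z1 s h.le]
    · have : s ≠ 0 := by linarith
      rw [mul_comm, mul_assoc, inv_mul_cancel₀ this, mul_one]
      exact ψ.le_one
  · intro s hs
    have : ψ s = 1 := by
      apply ψ.one_of_mem_closedBall
      rw [mem_closedBall, Real.dist_eq]
      show _ ≤ (R - 3 * ε) / 2
      rw [abs_le]
      constructor <;> linarith [hs.1, hs.2]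
    simp [this]
  · intro s hs
    simp [z1 s hs]
  · intro s hs
    simp [z2 s hs]

lemma exists_test (ε R : ℝ) (hε : 0 < ε) (hR : 3 * ε < R) :
    ∃ f : Euc 2 → ℝ, ContDiff ℝ (⊤ : ℕ∞) f ∧ (∀ x, ‖x‖ ≤ 2 * ε → f x = 1) ∧
      (∀ x, R + ε ≤ ‖x‖ → f x = 0) ∧
      Integrable (fun x => ‖fderiv ℝ f x‖ ^ 2) ∧
      ∫ x, ‖fderiv ℝ f x‖ ^ 2 ≤ 2 * π / Real.log (R / (3 * ε)) := by
  obtain ⟨g, gs, g0, g1, g2, g3, g4⟩ := exists_profile_s8 ε R hε hR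
  have gc : Continuous g := gs.continuous
  have gi : ∀ a b, IntervalIntegrable g volume a b := fun a b => gc.intervalIntegrable a b
  set M := ∫ s in (0:ℝ)..(R + ε), g s with hM
  have hlog : 0 < Real.log (R / (3 * ε)) := Real.log_pos (by rw [one_lt_div (by linarith)]; exact hR)
  have hMl : Real.log (R / (3 * ε)) ≤ M := by
    have e1 : ∫ s in (3 * ε)..R, g s = Real.log (R / (3 * ε)) := by
      rw [← integral_inv_of_pos (by linarith) (by linarith)]
      apply intervalIntegral.integral_congr
      intro s hs
      rw [uIcc_of_le hR.le] at hs
      exact g2 s hs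
    rw [← e1]
    exact intervalIntegral.integral_mono_interval (by linarith) hR.le (by linarith)
      (ae_of_all _ g0) (gi _ _)
  have hMp : 0 < M := hlog.trans_le hMl
  let F : ℝ → ℝ := fun r => 1 - (∫ s in (0:ℝ)..r, g s) / M
  have Fd : ∀ r, HasDerivAt F (-(g r / M)) r := by
    intro r
    have := ((gc.integral_hasStrictDerivAt 0 r).hasDerivAt.div_const M).const_sub 1
    exact this
  have Fs : ContDiff ℝ (⊤ : ℕ∞) F := by
    rw [contDiff_infty_iff_deriv]
    refine ⟨fun r => (Fd r).differentiableAt, ?_⟩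
    have : deriv F = fun r => -(g r / M) := funext fun r => (Fd r).deriv
    rw [this]
    exact (gs.div_const M).neg
  have F1 : ∀ r, r ≤ 2 * ε → F r = 1 := by
    intro r hr
    have : ∫ s in (0:ℝ)..r, g s = ∫ s in (0:ℝ)..r, (0:ℝ) := by
      apply intervalIntegral.integral_congr
      intro s hs
      apply g3
      rcases le_total 0 r with h | h
      · rw [uIcc_of_le h] at hs; exact hs.2.trans hr
      · rw [uIcc_of_ge h] at hs; exact hs.2.trans (by linarith)
    simp [F, this]
  have F0 : ∀ r, R + ε ≤ r → F r = 0 := by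
    intro r hr
    have : ∫ s in (R + ε)..r, g s = ∫ s in (R + ε)..r, (0:ℝ) := by
      apply intervalIntegral.integral_congr
      intro s hs
      apply g4
      rw [uIcc_of_le hr] at hs; exact hs.1
    have h2 : ∫ s in (0:ℝ)..r, g s = M := by
      rw [← intervalIntegral.integral_add_adjacent_intervals (gi 0 (R + ε)) (gi (R + ε) r), this]
      simp [hM]
    simp only [F, h2]
    rw [div_self hMp.ne', sub_self]
  let f : Euc 2 → ℝ := fun x => F ‖x‖
  have fs : ContDiff ℝ (⊤ : ℕ∞) f := by
    rw [contDiff_iff_contDiffAt]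
    intro x
    by_cases hx : x = 0
    · have : f =ᶠ[𝓝 x] fun _ => 1 := by
        have hb : ball (0 : Euc 2) (2 * ε) ∈ 𝓝 x := by
          rw [hx]; exact ball_mem_nhds _ (by linarith)
        filter_upwards [hb] with y hy
        exact F1 _ (by rw [mem_ball_zero_iff] at hy; exact hy.le)
      exact contDiffAt_const.congr_of_eventuallyEq this
    · exact Fs.contDiffAt.comp x (contDiffAt_norm ℝ hx)
  have fz : ∀ x, R + ε ≤ ‖x‖ → f x = 0 := fun x hx => F0 _ hx
  have fb : ∀ x, ‖fderiv ℝ f x‖ ^ 2 ≤ (g ‖x‖ / M) ^ 2 := by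
    intro x
    by_cases hx : x = 0
    · have : f =ᶠ[𝓝 x] fun _ => 1 := by
        have hb : ball (0 : Euc 2) (2 * ε) ∈ 𝓝 x := by
          rw [hx]; exact ball_mem_nhds _ (by linarith)
        filter_upwards [hb] with y hy
        exact F1 _ (by rw [mem_ball_zero_iff] at hy; exact hy.le)
      rw [this.fderiv_eq]
      simp
      positivity
    · have hn : DifferentiableAt ℝ (fun y : Euc 2 => ‖y‖) x :=
        (contDiffAt_norm ℝ hx (n := 1)).differentiableAt (by simp)
      have h1 := (Fd ‖x‖).comp_hasFDerivAt x hn.hasFDerivAt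
      have h2 : fderiv ℝ f x = -(g ‖x‖ / M) • fderiv ℝ (fun y : Euc 2 => ‖y‖) x := h1.fderiv
      have h3 : ‖fderiv ℝ (fun y : Euc 2 => ‖y‖) x‖ ≤ 1 :=
        NNReal.coe_one ▸ norm_fderiv_le_of_lipschitz ℝ lipschitzWith_one_norm
      rw [h2, norm_smul, mul_pow, Real.norm_eq_abs, sq_abs, neg_sq]
      have h4 : ‖fderiv ℝ (fun y : Euc 2 => ‖y‖) x‖ ^ 2 ≤ 1 := pow_le_one₀ (norm_nonneg _) h3
      exact mul_le_of_le_one_right (sq_nonneg _) h4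
  have hcs : ∀ (h : Euc 2 → ℝ), (∀ x, R + ε ≤ ‖x‖ → h x = 0) → HasCompactSupport h := by
    intro h hh
    apply HasCompactSupport.intro (isCompact_closedBall (0 : Euc 2) (R + ε))
    intro x hx
    apply hh
    rw [mem_closedBall_zero_iff, not_le] at hx
    exact hx.le
  have i2 : Integrable (fun x : Euc 2 => (g ‖x‖ / M) ^ 2) := by
    apply Continuous.integrable_of_hasCompactSupport (by fun_prop)
    apply hcs
    intro x hx
    simp [g4 _ hx]
  have i1 : Integrable (fun x => ‖fderiv ℝ f x‖ ^ 2) := by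
    have c1 : Continuous (fderiv ℝ f) := fs.continuous_fderiv (by simp)
    apply i2.mono' (by fun_prop)
    refine ae_of_all _ fun x => ?_
    rw [Real.norm_eq_abs, abs_of_nonneg (by positivity)]
    exact fb x
  refine ⟨f, fs, fun x hx => F1 _ hx, fz, i1, ?_⟩
  calc ∫ x, ‖fderiv ℝ f x‖ ^ 2 ≤ ∫ x : Euc 2, (g ‖x‖ / M) ^ 2 := integral_mono i1 i2 fb
    _ = 2 * π * ∫ y in Ioi (0:ℝ), y * (g y / M) ^ 2 := by
      rw [integral_fun_norm_addHaar volume (fun r => (g r / M) ^ 2)]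
      have : (volume : Measure (Euc 2)).real (ball 0 1) = π := by
        simp [Measure.real, Real.pi_pos.le]
      simp [this]
      ring
    _ ≤ 2 * π * ∫ y in Ioi (0:ℝ), g y / M ^ 2 := by
      have gcs : HasCompactSupport g := by
        apply HasCompactSupport.intro (isCompact_Icc (a := (0:ℝ)) (b := R + ε))
        intro x hx
        rw [mem_Icc, not_and_or, not_le, not_le] at hx
        rcases hx with hx | hx
        · exact g3 _ (by linarith)
        · exact g4 _ hx.le
      have gI : Integrable (fun y => g y / M ^ 2) :=
        (gc.integrable_of_hasCompactSupport gcs).div_const _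
      have pb : ∀ y, y * (g y / M) ^ 2 ≤ g y / M ^ 2 := by
        intro y
        rw [div_pow, ← mul_div_assoc]
        gcongr
        nlinarith [g0 y, g1 y]
      refine mul_le_mul_of_nonneg_left ?_ (by positivity)
      apply setIntegral_mono_on _ gI.integrableOn measurableSet_Ioi (fun y _ => pb y)
      apply gI.integrableOn.mono'
      · exact Continuous.aestronglyMeasurable (by fun_prop)
      · filter_upwards [ae_restrict_mem measurableSet_Ioi] with y hy
        rw [Real.norm_eq_abs, abs_of_nonneg]
        · exact pb y
        · have : (0:ℝ) < y := hy
          positivity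
    _ = 2 * π / M := by
      have : ∫ y in Ioi (0:ℝ), g y = M := by
        rw [hM, intervalIntegral.integral_of_le (by linarith)]
        apply setIntegral_eq_of_subset_of_forall_sdiff_eq_zero measurableSet_Ioi Ioc_subset_Ioi_self
        intro x hx
        apply g4
        have h1 : (0:ℝ) < x := hx.1
        by_contra hc
        exact hx.2 ⟨h1, (not_le.1 hc).le⟩
      rw [integral_div, this]
      field_simp
    _ ≤ _ := by gcongr

lemma cap_upper (L ε : ℝ) (hε : 0 < ε) (hR : 6 * ε < L) :
    (∃ e, e ∈ { e : ℝ | ∃ f : Euc 2 → ℝ, IsTest (ellipse ε L) f ∧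
    (∃ U, IsOpen U ∧ seg ε ⊆ U ∧ EqOn f 1 U) ∧ e = energy (ellipse ε L) f }) ∧
    cap (ellipse ε L) (seg ε) ≤ 2 * π / Real.log (L / (6 * ε)) := by
  obtain ⟨f, fs, f1, f0, fi, fe⟩ := exists_test ε (L / 2) hε (by linarith)
  have hn : ∀ x : Euc 2, ‖x‖ ^ 2 = x 0 ^ 2 + x 1 ^ 2 := by
    intro x
    rw [EuclideanSpace.norm_sq_eq]
    simp
  have hL : 0 < L := by linarith
  have hmem : energy (ellipse ε L) f ∈ { e : ℝ | ∃ f : Euc 2 → ℝ, IsTest (ellipse ε L) f ∧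
    (∃ U, IsOpen U ∧ seg ε ⊆ U ∧ EqOn f 1 U) ∧ e = energy (ellipse ε L) f } := by
    refine ⟨f, ⟨fs, ?_⟩, ⟨ball 0 (2 * ε), isOpen_ball, ?_, ?_⟩, rfl⟩
    · have h1 : tsupport f ⊆ closedBall 0 (L / 2 + ε) := by
        apply closure_minimal _ isClosed_closedBall
        intro x hx
        rw [mem_closedBall_zero_iff]
        by_contra hc
        exact hx (f0 x (not_le.1 hc).le)
      refine h1.trans ?_
      intro x hx
      rw [mem_closedBall_zero_iff] at hx
      have h2 : ‖x‖ ^ 2 < L ^ 2 := by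
        apply pow_lt_pow_left₀ _ (norm_nonneg _) (by simp)
        linarith
      rw [hn] at h2
      show x 0 ^ 2 / (L ^ 2 + ε ^ 2) + x 1 ^ 2 / L ^ 2 < 1
      calc x 0 ^ 2 / (L ^ 2 + ε ^ 2) + x 1 ^ 2 / L ^ 2 ≤ x 0 ^ 2 / L ^ 2 + x 1 ^ 2 / L ^ 2 := by
            gcongr
            nlinarith
        _ < 1 := by rw [← add_div, div_lt_one (by positivity)]; exact h2
    · rintro x ⟨hx, hx1⟩
      rw [mem_ball_zero_iff]
      have : ‖x‖ ^ 2 < (2 * ε) ^ 2 := by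
        rw [hn, hx1]
        nlinarith [hx.1, hx.2]
      exact lt_of_pow_lt_pow_left₀ 2 (by positivity) this
    · intro x hx
      rw [mem_ball_zero_iff] at hx
      exact f1 x hx.le
  refine ⟨⟨_, hmem⟩, ?_⟩
  have h3 : cap (ellipse ε L) (seg ε) ≤ energy (ellipse ε L) f := by
    apply csInf_le _ hmem
    refine ⟨0, ?_⟩
    rintro e ⟨f, -, -, rfl⟩
    exact integral_nonneg fun x => by positivity
  refine h3.trans ((setIntegral_le_integral fi (ae_of_all _ fun x => by positivity)).trans ?_)
  have e : L / (6 * ε) = L / 2 / (3 * ε) := by field_simp; norm_num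
  rw [e]
  exact fe

/-- The plane as a product, mapped to Euclidean space. -/
def toE (p : ℝ × ℝ) : Euc 2 := !₂[p.1, p.2]

lemma toE_mp : MeasurePreserving toE volume volume :=
  (PiLp.volume_preserving_toLp (Fin 2)).comp (volume_preserving_finTwoArrow ℝ).symm

lemma toE_emb : MeasurableEmbedding toE :=
  (MeasurableEquiv.toLp 2 (Fin 2 → ℝ)).measurableEmbedding.comp
    (MeasurableEquiv.finTwoArrow (α := ℝ)).symm.measurableEmbedding

/-- Elliptic coordinates, with the angle first. -/
def ell (ε : ℝ) (p : ℝ × ℝ) : ℝ × ℝ :=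
  (ε * (Real.cosh p.2 * Real.cos p.1), ε * (Real.sinh p.2 * Real.sin p.1))

/-- Derivative of elliptic coordinates. -/
def ellD (ε : ℝ) (p : ℝ × ℝ) : ℝ × ℝ →L[ℝ] ℝ × ℝ :=
  (Matrix.toLin (.finTwoProd ℝ) (.finTwoProd ℝ)
    !![-(ε * (Real.cosh p.2 * Real.sin p.1)), ε * (Real.sinh p.2 * Real.cos p.1);
      ε * (Real.sinh p.2 * Real.cos p.1),
      ε * (Real.cosh p.2 * Real.sin p.1)]).toContinuousLinearMap

lemma ell_hasFDerivAt (ε : ℝ) (p : ℝ × ℝ) : HasFDerivAt (ell ε) (ellD ε p) p := by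
  unfold ellD
  rw [Matrix.toLin_finTwoProd_toContinuousLinearMap]
  have hc := (Real.hasDerivAt_cos p.1).comp_hasFDerivAt p (hasFDerivAt_fst (𝕜 := ℝ))
  have hs := (Real.hasDerivAt_sin p.1).comp_hasFDerivAt p (hasFDerivAt_fst (𝕜 := ℝ))
  have hch := (Real.hasDerivAt_cosh p.2).comp_hasFDerivAt p (hasFDerivAt_snd (𝕜 := ℝ))
  have hsh := (Real.hasDerivAt_sinh p.2).comp_hasFDerivAt p (hasFDerivAt_snd (𝕜 := ℝ))
  have h1 := (hch.mul hc).const_mul ε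
  have h2 := (hsh.mul hs).const_mul ε
  refine (h1.prodMk h2).congr_fderiv ?_
  ext <;> simp [mul_comm]

lemma ellD_det (ε : ℝ) (p : ℝ × ℝ) : |(ellD ε p).det| =
    (ε * (Real.sinh p.2 * Real.cos p.1)) ^ 2 + (ε * (Real.cosh p.2 * Real.sin p.1)) ^ 2 := by
  unfold ellD
  simp only [LinearMap.det_toContinuousLinearMap, LinearMap.det_toLin, Matrix.det_fin_two_of]
  rw [← abs_neg, abs_of_nonneg]
  · ring
  · nlinarith [sq_nonneg (ε * (Real.sinh p.2 * Real.cos p.1)),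
      sq_nonneg (ε * (Real.cosh p.2 * Real.sin p.1))]

lemma ell_injOn (ε : ℝ) (hε : 0 < ε) (X : ℝ) :
    InjOn (ell ε) (Ioc (-π) π ×ˢ Ioc 0 X) := by
  rintro ⟨a, s⟩ ⟨ha, hs⟩ ⟨b, t⟩ ⟨hb, ht⟩ h
  simp only [ell, Prod.mk.injEq, mul_eq_mul_left_iff, hε.ne', or_false] at h ha hs hb ht
  obtain ⟨h1, h2⟩ := h
  have key : ∀ x y : ℝ, (Real.cosh x * Real.cos y + 1) ^ 2 + (Real.sinh x * Real.sin y) ^ 2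
      = (Real.cosh x + Real.cos y) ^ 2 := by
    intro x y
    rw [mul_pow (Real.sinh x), Real.sinh_sq, Real.sin_sq]; ring
  have key' : ∀ x y : ℝ, (Real.cosh x * Real.cos y - 1) ^ 2 + (Real.sinh x * Real.sin y) ^ 2
      = (Real.cosh x - Real.cos y) ^ 2 := by
    intro x y
    rw [mul_pow (Real.sinh x), Real.sinh_sq, Real.sin_sq]; ring
  have e1 : Real.cosh s + Real.cos a = Real.cosh t + Real.cos b := by
    rw [← sq_eq_sq₀, ← key, ← key, h1, h2]
    · linarith [Real.one_le_cosh s, Real.neg_one_le_cos a]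
    · linarith [Real.one_le_cosh t, Real.neg_one_le_cos b]
  have e2 : Real.cosh s - Real.cos a = Real.cosh t - Real.cos b := by
    rw [← sq_eq_sq₀, ← key', ← key', h1, h2]
    · linarith [Real.one_le_cosh s, Real.cos_le_one a]
    · linarith [Real.one_le_cosh t, Real.cos_le_one b]
  have e3 : s = t := by
    have : Real.cosh s = Real.cosh t := by linarith
    exact Real.cosh_strictMonoOn.injOn hs.1.le ht.1.le this
  have e4 : Real.cos a = Real.cos b := by linarith
  have e5 : Real.sin a = Real.sin b := by
    rw [e3] at h2
    exact mul_left_cancel₀ (Real.sinh_pos_iff.2 ht.1).ne' h2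
  have e6 : a = b := by
    have := Real.Angle.cos_sin_inj e4 e5
    have h3 := congrArg Real.Angle.toReal this
    rwa [Real.Angle.toReal_coe_eq_self_iff.2 ha, Real.Angle.toReal_coe_eq_self_iff.2 hb] at h3
  rw [e3, e6]

lemma energy_lower_s8 (L ε : ℝ) (hL : 0 < L) (hε : 0 < ε) (f : Euc 2 → ℝ)
    (hf : IsTest (ellipse ε L) f) (h1 : EqOn f 1 (seg ε)) :
    2 * π / Real.arsinh (L / ε) ≤ energy (ellipse ε L) f := by
  obtain ⟨fs, fsup⟩ := hf
  set X := Real.arsinh (L / ε) with hX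
  have hXp : 0 < X := Real.arsinh_pos_iff.2 (by positivity)
  have c1 : Continuous (fderiv ℝ f) := fs.continuous_fderiv (by simp)
  have fd : Differentiable ℝ f := fs.differentiable (by simp)
  have fz : ∀ x, x ∉ ellipse ε L → f x = 0 := fun x hx =>
    image_eq_zero_of_notMem_tsupport fun h => hx (fsup h)
  have fdz : ∀ x, x ∉ ellipse ε L → fderiv ℝ f x = 0 := by
    intro x hx
    by_contra h
    exact hx (fsup (support_fderiv_subset ℝ h))
  -- the ellipse is bounded
  have hbd : ellipse ε L ⊆ closedBall 0 (2 * (L + ε)) := by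
    intro x hx
    rw [mem_closedBall_zero_iff]
    have hx' : x 0 ^ 2 / (L ^ 2 + ε ^ 2) + x 1 ^ 2 / L ^ 2 < 1 := hx
    have hn : ‖x‖ ^ 2 = x 0 ^ 2 + x 1 ^ 2 := by
      rw [EuclideanSpace.norm_sq_eq]; simp
    have a1 : x 0 ^ 2 / (L ^ 2 + ε ^ 2) < 1 := by
      have : 0 ≤ x 1 ^ 2 / L ^ 2 := by positivity
      linarith
    have a2 : x 1 ^ 2 / L ^ 2 < 1 := by
      have : 0 ≤ x 0 ^ 2 / (L ^ 2 + ε ^ 2) := by positivity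
      linarith
    rw [div_lt_one (by positivity)] at a1 a2
    apply le_of_sq_le_sq _ (by positivity)
    rw [hn]
    nlinarith [mul_pos hL hε]
  have fc : HasCompactSupport (fun x => ‖fderiv ℝ f x‖ ^ 2) := by
    apply HasCompactSupport.intro (isCompact_closedBall (0 : Euc 2) (2 * (L + ε)))
    intro x hx
    rw [fdz x fun h => hx (hbd h)]
    simp
  have fi : Integrable (fun x => ‖fderiv ℝ f x‖ ^ 2) :=
    Continuous.integrable_of_hasCompactSupport (by fun_prop) fc
  have hE : energy (ellipse ε L) f = ∫ p : ℝ × ℝ, ‖fderiv ℝ f (toE p)‖ ^ 2 := by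
    unfold energy
    rw [setIntegral_eq_integral_of_forall_compl_eq_zero]
    · exact (toE_mp.integral_comp toE_emb (fun x => ‖fderiv ℝ f x‖ ^ 2)).symm
    · intro x hx
      rw [fdz x hx]; simp
  have fi' : Integrable (fun p : ℝ × ℝ => ‖fderiv ℝ f (toE p)‖ ^ 2) :=
    (toE_mp.integrable_comp_emb toE_emb).2 fi
  have toEc : Continuous toE := by unfold toE; fun_prop
  have ellc : Continuous (ell ε) := by unfold ell; fun_prop
  let v : ℝ × ℝ → ℝ × ℝ := fun p =>
    (ε * (Real.sinh p.2 * Real.cos p.1), ε * (Real.cosh p.2 * Real.sin p.1))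
  have vc : Continuous v := by fun_prop
  let u : ℝ × ℝ → ℝ := fun p => fderiv ℝ f (toE (ell ε p)) (toE (v p))
  have uc : Continuous u := by fun_prop
  have hu : ∀ a s, HasDerivAt (fun t => f (toE (ell ε (a, t)))) (u (a, s)) s := by
    intro a s
    have d1 : HasDerivAt (fun t => toE (ell ε (a, t))) (toE (v (a, s))) s := by
      have d2 : HasDerivAt (fun t => ![(ell ε (a, t)).1, (ell ε (a, t)).2])
          ![(v (a, s)).1, (v (a, s)).2] s := by
        rw [hasDerivAt_pi]
        intro i
        fin_cases i
        · simpa [ell, v] using ((Real.hasDerivAt_cosh s).mul_const (Real.cos a)).const_mul ε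
        · simpa [ell, v] using ((Real.hasDerivAt_sinh s).mul_const (Real.sin a)).const_mul ε
      exact (PiLp.continuousLinearEquiv 2 ℝ
        (fun _ : Fin 2 => ℝ)).symm.toContinuousLinearMap.hasFDerivAt.comp_hasDerivAt s d2
    exact (fd _).hasFDerivAt.comp_hasDerivAt s d1
  have hb0 : ∀ a, f (toE (ell ε (a, 0))) = 1 := by
    intro a
    apply h1
    refine ⟨?_, ?_⟩
    · simp only [toE, ell]
      simp
      constructor <;> nlinarith [Real.cos_le_one a, Real.neg_one_le_cos a]
    · simp [toE, ell]
  have hbX : ∀ a, f (toE (ell ε (a, X))) = 0 := by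
    intro a
    apply fz
    intro hc
    have hc' : (ε * (Real.cosh X * Real.cos a)) ^ 2 / (L ^ 2 + ε ^ 2) +
      (ε * (Real.sinh X * Real.sin a)) ^ 2 / L ^ 2 < 1 := hc
    have s1 : Real.sinh X = L / ε := Real.sinh_arsinh _
    have s2 : Real.cosh X ^ 2 = (L / ε) ^ 2 + 1 := by rw [Real.cosh_sq, s1]
    have e1 : (ε * (Real.cosh X * Real.cos a)) ^ 2 / (L ^ 2 + ε ^ 2) = Real.cos a ^ 2 := by
      rw [mul_pow, mul_pow, s2]; field_simp
    have e2 : (ε * (Real.sinh X * Real.sin a)) ^ 2 / L ^ 2 = Real.sin a ^ 2 := by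
      rw [s1]; field_simp
    rw [e1, e2] at hc'
    linarith [Real.sin_sq_add_cos_sq a]
  have hint : ∀ a, ∫ s in (0:ℝ)..X, u (a, s) = -1 := by
    intro a
    rw [intervalIntegral.integral_eq_sub_of_hasDerivAt (fun s _ => hu a s)
      (Continuous.intervalIntegrable (by fun_prop) _ _), hb0, hbX]
    norm_num
  set S : Set (ℝ × ℝ) := Ioc (-π) π ×ˢ Ioc 0 X with hS
  have hSm : MeasurableSet S := measurableSet_Ioc.prod measurableSet_Ioc
  have hSI : ∀ w : ℝ × ℝ → ℝ, Continuous w → IntegrableOn w S := by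
    intro w hw
    refine (hw.continuousOn.integrableOn_compact
      (isCompact_Icc.prod isCompact_Icc : IsCompact (Icc (-π) π ×ˢ Icc 0 X))).mono_set ?_
    exact prod_mono Ioc_subset_Icc_self Ioc_subset_Icc_self
  have hdet : ∀ p, |(ellD ε p).det| = ‖toE (v p)‖ ^ 2 := by
    intro p
    rw [ellD_det, EuclideanSpace.norm_sq_eq]
    simp [toE, v]
  have hpi := Real.pi_pos
  calc 2 * π / X = ∫ p in S, (-(2 / X) * u p - 1 / X ^ 2) := by
        rw [hS, Measure.volume_eq_prod, setIntegral_prod _ (hSI _ (by fun_prop))]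
        have : ∀ a, ∫ s in Ioc 0 X, (-(2 / X) * u (a, s) - 1 / X ^ 2) = 1 / X := by
          intro a
          rw [← intervalIntegral.integral_of_le hXp.le, intervalIntegral.integral_sub,
            intervalIntegral.integral_const_mul, hint]
          · simp; field_simp; norm_num
          · exact Continuous.intervalIntegrable (by fun_prop) _ _
          · exact Continuous.intervalIntegrable (by fun_prop) _ _
        simp_rw [this]
        simp [Measure.real]
        rw [ENNReal.toReal_ofReal (by linarith)]
        ring
    _ ≤ ∫ p in S, |(ellD ε p).det| • ‖fderiv ℝ f (toE (ell ε p))‖ ^ 2 := by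
        simp_rw [hdet]
        refine setIntegral_mono_on (hSI _ (by fun_prop)) (hSI _ ?_) hSm ?_
        · simp only [smul_eq_mul]; fun_prop
        · intro p _
          have b1 : |u p| ≤ ‖fderiv ℝ f (toE (ell ε p))‖ * ‖toE (v p)‖ :=
            (fderiv ℝ f (toE (ell ε p))).le_opNorm (toE (v p))
          have b2 : u p ^ 2 ≤ ‖toE (v p)‖ ^ 2 * ‖fderiv ℝ f (toE (ell ε p))‖ ^ 2 := by
            rw [← mul_pow, mul_comm, ← sq_abs]
            exact pow_le_pow_left₀ (abs_nonneg _) b1 2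
          have b3 : 0 ≤ (u p + 1 / X) ^ 2 := sq_nonneg _
          have b4 : (u p + 1 / X) ^ 2 = u p ^ 2 + (2 / X) * u p + 1 / X ^ 2 := by
            field_simp; ring
          rw [smul_eq_mul]
          linarith
    _ = ∫ p in ell ε '' S, ‖fderiv ℝ f (toE p)‖ ^ 2 :=
        (integral_image_eq_integral_abs_det_fderiv_smul volume hSm
          (fun p _ => (ell_hasFDerivAt ε p).hasFDerivWithinAt) (ell_injOn ε hε X)
          (fun p => ‖fderiv ℝ f (toE p)‖ ^ 2)).symm
    _ ≤ ∫ p : ℝ × ℝ, ‖fderiv ℝ f (toE p)‖ ^ 2 :=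
        setIntegral_le_integral fi' (ae_of_all _ fun x => by positivity)
    _ = energy (ellipse ε L) f := hE.symm

/-- the condenser capacity of the segment s_ε in the ellipse E_ε(L) satisfies
Cap = 2π/|log ε| · (1 + O(1/|log ε|)) as ε → 0⁺. -/
theorem stmt_8 (L : ℝ) (hL : 0 < L) :
    (fun ε => cap (ellipse ε L) (seg ε) - 2 * Real.pi / |Real.log ε|)
      =O[𝓝[>] (0:ℝ)] (fun ε => 1 / (Real.log ε) ^ 2) := by
  set A := |Real.log (L / 6)| with hA
  set B := Real.log (2 * L + 1) with hB
  have hB0 : 0 ≤ B := Real.log_nonneg (by linarith)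
  have hA0 : 0 ≤ A := abs_nonneg _
  have hpi := Real.pi_pos
  apply IsBigO.of_bound (2 * π * (2 * A + B))
  have ev1 : ∀ᶠ ε in 𝓝[>] (0:ℝ), Real.log ε < -(2 * A + 1) :=
    Real.tendsto_log_nhdsGT_zero.eventually_lt_atBot _
  have ev2 : ∀ᶠ ε in 𝓝[>] (0:ℝ), ε ∈ Ioo 0 (min 1 (L / 6)) :=
    Ioo_mem_nhdsGT (by positivity)
  filter_upwards [ev1, ev2] with ε e1 e2
  have hε : 0 < ε := e2.1
  have hε1 : ε < 1 := e2.2.trans_le (min_le_left _ _)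
  have hεL : 6 * ε < L := by linarith [e2.2.trans_le (min_le_right 1 (L / 6))]
  set l := -Real.log ε with hl
  have hll : 2 * A + 1 < l := by linarith
  have habs : |Real.log ε| = l := abs_of_neg (by linarith)
  have hsq : Real.log ε ^ 2 = l ^ 2 := by rw [hl]; ring
  have hlp : 0 < l := by linarith
  obtain ⟨hne, hup⟩ := cap_upper L ε hε hεL
  have hlow : 2 * π / Real.arsinh (L / ε) ≤ cap (ellipse ε L) (seg ε) := by
    apply le_csInf hne
    rintro e ⟨f, hf, ⟨U, -, hU, hfU⟩, rfl⟩
    exact energy_lower_s8 L ε hL hε f hf (hfU.mono hU)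
  have hXp : 0 < Real.arsinh (L / ε) := Real.arsinh_pos_iff.2 (by positivity)
  have hX : Real.arsinh (L / ε) ≤ l + B := by
    have hy : 0 < L / ε := by positivity
    have h1 : √(1 + (L / ε) ^ 2) ≤ 1 + L / ε := by
      apply Real.sqrt_le_iff.2
      constructor
      · positivity
      · nlinarith
    have h2 : L / ε + √(1 + (L / ε) ^ 2) ≤ (2 * L + 1) / ε := by
      have h3 : 1 ≤ 1 / ε := by rw [le_div_iff₀ hε]; linarith
      have h4 : (2 * L + 1) / ε = 2 * (L / ε) + 1 / ε := by ring
      linarith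
    have h5 := Real.log_le_log (by positivity) h2
    rw [Real.log_div (by positivity) hε.ne'] at h5
    unfold Real.arsinh
    linarith
  have hM : l - A ≤ Real.log (L / (6 * ε)) := by
    have h1 : L / (6 * ε) = L / 6 / ε := by field_simp
    rw [h1, Real.log_div (by positivity) hε.ne']
    linarith [neg_abs_le (Real.log (L / 6))]
  have hlA : l / 2 ≤ l - A := by linarith
  have up2 : cap (ellipse ε L) (seg ε) ≤ 2 * π / l + 2 * π * (2 * A) / l ^ 2 := by
    have h1 : 2 * π / Real.log (L / (6 * ε)) ≤ 2 * π / (l - A) := by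
      gcongr
      linarith
    have h2 : 2 * π / (l - A) ≤ 2 * π / l + 2 * π * (2 * A) / l ^ 2 := by
      have h3 : 2 * π / l + 2 * π * (2 * A) / l ^ 2 = 2 * π * (l + 2 * A) / l ^ 2 := by
        field_simp
      rw [h3, div_le_div_iff₀ (by linarith) (by positivity), mul_assoc (2 * π)]
      apply mul_le_mul_of_nonneg_left _ (by positivity)
      nlinarith
    linarith
  have lo2 : 2 * π / l - 2 * π * B / l ^ 2 ≤ cap (ellipse ε L) (seg ε) := by
    have h1 : 2 * π / (l + B) ≤ 2 * π / Real.arsinh (L / ε) := by gcongr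
    have h2 : 2 * π / l - 2 * π * B / l ^ 2 ≤ 2 * π / (l + B) := by
      have h3 : 2 * π / l - 2 * π * B / l ^ 2 = 2 * π * (l - B) / l ^ 2 := by
        field_simp
      rw [h3, div_le_div_iff₀ (by positivity) (by positivity), mul_assoc (2 * π)]
      apply mul_le_mul_of_nonneg_left _ (by positivity)
      nlinarith
    linarith
  rw [habs, hsq, Real.norm_eq_abs, Real.norm_eq_abs, abs_of_nonneg (by positivity : 0 ≤ 1 / l ^ 2)]
  have t1 : 0 ≤ 2 * π * (2 * A) / l ^ 2 := by positivity
  have t2 : 0 ≤ 2 * π * B / l ^ 2 := by positivity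
  have t3 : 2 * π * (2 * A + B) * (1 / l ^ 2) = 2 * π * (2 * A) / l ^ 2 + 2 * π * B / l ^ 2 := by
    ring
  rw [t3, abs_le]
  constructor <;> linarith
end
end
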